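/- arXiv:2004.03832 — 2 statements merged into one kernel-verified Lean document; each statement's English description precedes it below -/
import Mathlib

section
/- Let μ ≥ 0 with μ ≠ 1/4 and let d ≥ 1. Then there exist N > 0 and C > 0 such that for all t ≥ 0 and all ξ ∈ ℝ^d \ {0} with (1+t)|ξ| ≥ N, one has |e_+(t,ξ)| ≤ C, |e_−(t,ξ)| ≤ C, |ė_+(t,ξ)| ≤ C|ξ| and |ė_−(t,ξ)| ≤ C|ξ|. -/
open MeasureTheory Real Set

noncomputable section

/-- Bessel function of the first kind `J_ν(τ)`, defined by its power series,
using the principal branch of `(τ/2)^(ν+2k)`. -/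
def besselJ (ν : ℂ) (τ : ℝ) : ℂ :=
  ∑' k : ℕ, ((-1 : ℂ) ^ k / ((Nat.factorial k : ℂ) * Complex.Gamma (ν + k + 1))) *
    ((τ : ℂ) / 2) ^ (ν + 2 * (k : ℂ))

/-- Bessel function of the second kind (Neumann function) `Y_ν(τ)` for `ν ∉ ℤ`. -/
def besselY (ν : ℂ) (τ : ℝ) : ℂ :=
  (besselJ ν τ * Complex.cos (ν * (π : ℂ)) - besselJ (-ν) τ) / Complex.sin (ν * (π : ℂ))

/-- The index `ν` associated with the mass parameter `μ`. -/
def nuOf (μ : ℝ) : ℂ :=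
  if μ ≤ 1 / 4 then ((Real.sqrt (1 - 4 * μ) / 2 : ℝ) : ℂ)
  else Complex.I * ((Real.sqrt (4 * μ - 1) / 2 : ℝ) : ℂ)

/-- `e₊(t,ξ) = τ^{1/2} J_ν(τ)` with `τ = (1+t) r`, `r = |ξ|`. -/
def ePlus (ν : ℂ) (r t : ℝ) : ℂ :=
  (Real.sqrt ((1 + t) * r) : ℂ) * besselJ ν ((1 + t) * r)

/-- `e₋(t,ξ) = τ^{1/2} Y_ν(τ)` with `τ = (1+t) r`, `r = |ξ|`. -/
def eMinus (ν : ℂ) (r t : ℝ) : ℂ :=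
  (Real.sqrt ((1 + t) * r) : ℂ) * besselY ν ((1 + t) * r)

/-- `ė₊ = ∂ₜ e₊`. -/
def ePlusDot (ν : ℂ) (r t : ℝ) : ℂ := deriv (ePlus ν r) t

/-- `ė₋ = ∂ₜ e₋`. -/
def eMinusDot (ν : ℂ) (r t : ℝ) : ℂ := deriv (eMinus ν r) t

/-- The Fourier multiplier `E₀(t,t₀,ξ)` of the Klein–Gordon propagator. -/
def E0 (ν : ℂ) (r t t₀ : ℝ) : ℂ :=
  (ePlus ν r t * eMinusDot ν r t₀ - ePlusDot ν r t₀ * eMinus ν r t) /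
    (ePlus ν r t₀ * eMinusDot ν r t₀ - ePlusDot ν r t₀ * eMinus ν r t₀)

/-- The Fourier multiplier `E₁(t,t₀,ξ)` of the Klein–Gordon propagator. -/
def E1 (ν : ℂ) (r t t₀ : ℝ) : ℂ :=
  (ePlus ν r t₀ * eMinus ν r t - ePlus ν r t * eMinus ν r t₀) /
    (ePlus ν r t₀ * eMinusDot ν r t₀ - ePlusDot ν r t₀ * eMinus ν r t₀)

/-- `Ė₀ = ∂ₜ E₀` (derivative in the first time variable). -/
def E0dot (ν : ℂ) (r t t₀ : ℝ) : ℂ := deriv (fun s => E0 ν r s t₀) t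

/-- `Ė₁ = ∂ₜ E₁` (derivative in the first time variable). -/
def E1dot (ν : ℂ) (r t t₀ : ℝ) : ℂ := deriv (fun s => E1 ν r s t₀) t

/-- The Neumann function `Y₀(τ)` (logarithmic case `ν = 0`). -/
def besselY0 (τ : ℝ) : ℂ :=
  (2 / (π : ℂ)) * (Complex.log ((τ : ℂ) / 2) + (Real.eulerMascheroniConstant : ℂ)) * besselJ 0 τ +
    (2 / (π : ℂ)) * ∑' k : ℕ,
      ((-1 : ℂ) ^ ((k + 1) + 1) * ((harmonic (k + 1) : ℚ) : ℂ) /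
          ((Nat.factorial (k + 1) : ℂ)) ^ 2) * ((τ : ℂ) / 2) ^ (2 * (k + 1))

/-- `e₋(t,ξ) = τ^{1/2} Y₀(τ)` in the case `μ = 1/4`, `ν = 0`. -/
def eMinusZ (r t : ℝ) : ℂ :=
  (Real.sqrt ((1 + t) * r) : ℂ) * besselY0 ((1 + t) * r)

/-- `ė₋ = ∂ₜ e₋` in the case `μ = 1/4`. -/
def eMinusZDot (r t : ℝ) : ℂ := deriv (eMinusZ r) t

/-- `E₀(t,t₀,ξ)` in the case `μ = 1/4`, `ν = 0`. -/
def E0Z (r t t₀ : ℝ) : ℂ :=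
  (ePlus 0 r t * eMinusZDot r t₀ - ePlusDot 0 r t₀ * eMinusZ r t) /
    (ePlus 0 r t₀ * eMinusZDot r t₀ - ePlusDot 0 r t₀ * eMinusZ r t₀)

/-- `E₁(t,t₀,ξ)` in the case `μ = 1/4`, `ν = 0`. -/
def E1Z (r t t₀ : ℝ) : ℂ :=
  (ePlus 0 r t₀ * eMinusZ r t - ePlus 0 r t * eMinusZ r t₀) /
    (ePlus 0 r t₀ * eMinusZDot r t₀ - ePlusDot 0 r t₀ * eMinusZ r t₀)

/-- `Ė₀` in the case `μ = 1/4`. -/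
def E0Zdot (r t t₀ : ℝ) : ℂ := deriv (fun s => E0Z r s t₀) t

/-- `Ė₁` in the case `μ = 1/4`. -/
def E1Zdot (r t t₀ : ℝ) : ℂ := deriv (fun s => E1Z r s t₀) t


/-- The `k`-th Taylor coefficient of `z ↦ z^(-ν/2) J_ν(2 √z)`. -/
def besselCoeff (ν : ℂ) (k : ℕ) : ℂ :=
  (-1 : ℂ) ^ k / ((Nat.factorial k : ℂ) * Complex.Gamma (ν + k + 1))

/-- The entire function `z ↦ z^(-ν/2) J_ν(2 √z)`. -/
def besselEntire (ν z : ℂ) : ℂ := ∑' k : ℕ, besselCoeff ν k * z ^ k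

lemma besselCoeff_succ (ν : ℂ) (k : ℕ) :
    ((k : ℂ) + 1) * besselCoeff ν (k + 1) = -besselCoeff (ν + 1) k := by
  have hk : (k : ℂ) + 1 ≠ 0 := Nat.cast_add_one_ne_zero k
  have hf : (Nat.factorial k : ℂ) ≠ 0 := by exact_mod_cast Nat.factorial_ne_zero k
  simp only [besselCoeff, Nat.factorial_succ, Nat.cast_mul, Nat.cast_add, Nat.cast_one, pow_succ]
  rw [show ν + ((k : ℂ) + 1) + 1 = ν + 1 + k + 1 by ring]
  simp only [div_eq_mul_inv, mul_inv]
  field_simp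

lemma besselCoeff_eq_mul (ν : ℂ) (k : ℕ) :
    besselCoeff ν k = (ν + k + 1) * besselCoeff (ν + 1) k := by
  have h := Complex.one_div_Gamma_eq_self_mul_one_div_Gamma_add_one (ν + k + 1)
  simp only [besselCoeff, div_eq_mul_inv, mul_inv]
  rw [h, show ν + 1 + (k : ℂ) + 1 = ν + k + 1 + 1 by ring]
  ring

lemma summable_norm_besselCoeff (ν z : ℂ) : Summable fun k => ‖besselCoeff ν k * z ^ k‖ := by
  refine Summable.norm (f := fun k => besselCoeff ν k * z ^ k)
    (summable_of_ratio_norm_eventually_le (r := 1 / 2) (by norm_num) ?_)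
  filter_upwards [Filter.eventually_ge_atTop ⌈‖ν‖ + 2 * ‖z‖⌉₊] with k hk
  have hk' : ‖ν‖ + 2 * ‖z‖ ≤ k := (Nat.le_ceil _).trans (by exact_mod_cast hk)
  have hrec : ((k : ℂ) + 1) * (ν + k + 1) * besselCoeff ν (k + 1) = -besselCoeff ν k := by
    rw [besselCoeff_eq_mul ν k, ← mul_neg, ← besselCoeff_succ]; ring
  have hn1 : ‖(k : ℂ) + 1‖ = k + 1 := by
    rw [← Nat.cast_add_one, Complex.norm_natCast]; push_cast; ring
  have hn2 : 1 ≤ ‖ν + k + 1‖ := by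
    have h := norm_sub_le (ν + k + 1) ν
    rw [show ν + (k : ℂ) + 1 - ν = k + 1 by ring, hn1] at h
    nlinarith [norm_nonneg z, norm_nonneg ν]
  have hn := congrArg norm hrec
  rw [norm_mul, norm_mul, norm_neg, hn1] at hn
  rw [norm_mul, norm_mul, ← hn, pow_succ, norm_mul]
  have hz : ‖z‖ ≤ 1 / 2 * (((k : ℝ) + 1) * ‖ν + k + 1‖) := by
    nlinarith [norm_nonneg ν, norm_nonneg z]
  calc ‖besselCoeff ν (k + 1)‖ * (‖z ^ k‖ * ‖z‖)
      ≤ ‖besselCoeff ν (k + 1)‖ * (‖z ^ k‖ * (1 / 2 * (((k : ℝ) + 1) * ‖ν + k + 1‖))) := by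
        gcongr
    _ = _ := by ring

lemma hasDerivAt_besselEntire (ν z : ℂ) :
    HasDerivAt (besselEntire ν) (-besselEntire (ν + 1) z) z := by
  set R : ℝ := ‖z‖ + 1 with hR
  have hR0 : 0 ≤ R := by positivity
  have hd : ∀ (w : ℂ) (k : ℕ), besselCoeff ν (k + 1) * (((k + 1 : ℕ) : ℂ) * w ^ k) =
      -(besselCoeff (ν + 1) k * w ^ k) := by
    intro w k
    have h := besselCoeff_succ ν k
    push_cast
    linear_combination w ^ k * h
  have h := hasDerivAt_tsum_of_isPreconnected
    (g := fun k w => besselCoeff ν (k + 1) * w ^ (k + 1))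
    (g' := fun k w => besselCoeff ν (k + 1) * (((k + 1 : ℕ) : ℂ) * w ^ k))
    (u := fun k => ‖besselCoeff (ν + 1) k * (R : ℂ) ^ k‖) (t := Metric.ball 0 R) (y₀ := 0) (y := z)
    (summable_norm_besselCoeff _ _) Metric.isOpen_ball (convex_ball _ _).isPreconnected
    (fun k w _ => by simpa using (hasDerivAt_pow (k + 1) w).const_mul (besselCoeff ν (k + 1)))
    (fun k w hw => by
      rw [hd, norm_neg, norm_mul, norm_mul, norm_pow, norm_pow, Complex.norm_real,
        Real.norm_of_nonneg hR0]
      have : ‖w‖ ≤ R := by simpa using (mem_ball_zero_iff.1 hw).le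
      gcongr)
    (by simp [hR]; positivity) (by simp) (by simp [hR])
  have he : besselEntire ν =
      fun w => besselCoeff ν 0 + ∑' k : ℕ, besselCoeff ν (k + 1) * w ^ (k + 1) := by
    funext w
    rw [besselEntire, (summable_norm_besselCoeff ν w).of_norm.tsum_eq_zero_add]
    simp
  rw [he]
  refine (h.const_add (besselCoeff ν 0)).congr_deriv ?_
  simp only [hd, tsum_neg, besselEntire]

lemma mul_besselEntire_add_two (ν z : ℂ) :
    z * besselEntire (ν + 2) z = (ν + 1) * besselEntire (ν + 1) z - besselEntire ν z := by
  have h0 := (summable_norm_besselCoeff ν z).of_norm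
  have h1 := (summable_norm_besselCoeff (ν + 1) z).of_norm
  simp only [besselEntire]
  rw [← tsum_mul_left, ← tsum_mul_left, ← (h1.mul_left (ν + 1)).tsum_sub h0,
    ((h1.mul_left (ν + 1)).sub h0).tsum_eq_zero_add]
  have hz : (ν + 1) * (besselCoeff (ν + 1) 0 * z ^ 0) - besselCoeff ν 0 * z ^ 0 = 0 := by
    rw [besselCoeff_eq_mul ν 0]; simp
  rw [hz, zero_add]
  refine tsum_congr fun k => ?_
  have hs := besselCoeff_succ (ν + 1) k
  rw [besselCoeff_eq_mul ν (k + 1)]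
  rw [show ν + 1 + 1 = ν + 2 by ring] at hs
  push_cast
  linear_combination z ^ (k + 1) * hs

/-- `√x J_ν(x)` in terms of `besselEntire`. -/
lemma sqrt_mul_besselJ (ν : ℂ) {x : ℝ} (hx : 0 < x) :
    (Real.sqrt x : ℂ) * besselJ ν x =
      (1 / 2 : ℂ) ^ ν * ((x : ℂ) ^ (ν + 1 / 2) * besselEntire ν ((x : ℂ) ^ 2 / 4)) := by
  have hxc : (x : ℂ) ≠ 0 := by exact_mod_cast hx.ne'
  have hx2 : (x : ℂ) / 2 ≠ 0 := by simpa using hxc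
  have hsplit : ((x : ℂ) / 2) ^ ν = (1 / 2 : ℂ) ^ ν * (x : ℂ) ^ ν := by
    have h := Complex.mul_cpow_ofReal_nonneg (a := 1 / 2) (b := x) (by norm_num) hx.le ν
    push_cast at h
    rw [← h]; congr 1; ring
  have hJ : besselJ ν x = ((x : ℂ) / 2) ^ ν * besselEntire ν ((x : ℂ) ^ 2 / 4) := by
    rw [besselJ, besselEntire, ← tsum_mul_left]
    refine tsum_congr fun k => ?_
    rw [Complex.cpow_add _ _ hx2, show (2 * (k : ℂ)) = ((2 * k : ℕ) : ℂ) by push_cast; ring,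
      Complex.cpow_natCast, pow_mul, besselCoeff,
      show ((x : ℂ) / 2) ^ 2 = (x : ℂ) ^ 2 / 4 by ring]
    ring
  have hsq : (Real.sqrt x : ℂ) = (x : ℂ) ^ (1 / 2 : ℂ) := by
    rw [Real.sqrt_eq_rpow, Complex.ofReal_cpow hx.le]; push_cast; rfl
  rw [hJ, hsplit, hsq, Complex.cpow_add _ _ hxc]
  ring

lemma hasDerivAt_ofReal_cpow_mul_besselEntire (s ν : ℂ) {x : ℝ} (hx : 0 < x) :
    HasDerivAt (fun y : ℝ => (y : ℂ) ^ s * besselEntire ν ((y : ℂ) ^ 2 / 4))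
      (s * (x : ℂ) ^ (s - 1) * besselEntire ν ((x : ℂ) ^ 2 / 4) -
        (x : ℂ) ^ (s + 1) / 2 * besselEntire (ν + 1) ((x : ℂ) ^ 2 / 4)) x := by
  have hxc : (x : ℂ) ≠ 0 := by exact_mod_cast hx.ne'
  have hpow : HasDerivAt (fun z : ℂ => z ^ s) (s * (x : ℂ) ^ (s - 1)) x := by
    simpa using (hasDerivAt_id (x : ℂ)).cpow_const (c := s)
      (by simpa using Complex.ofReal_mem_slitPlane.2 hx)
  have hin : HasDerivAt (fun z : ℂ => z ^ 2 / 4) ((x : ℂ) / 2) x := by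
    refine (((hasDerivAt_id (x : ℂ)).pow 2).div_const 4).congr_deriv ?_
    simp only [id, Nat.cast_ofNat, Nat.add_one_sub_one, pow_one, mul_one]; ring
  have hE := (hasDerivAt_besselEntire ν ((x : ℂ) ^ 2 / 4)).comp (x : ℂ) hin
  refine (hpow.mul hE).comp_ofReal.congr_deriv ?_
  simp only [Function.comp]
  rw [Complex.cpow_add _ _ hxc, Complex.cpow_one]
  ring

/-- Solutions of `u'' + (1 + μ / x²) u = 0` with `μ ≥ 0` are bounded on `[1, ∞)` together with
their first derivative, since the energy `|u'|² + (1 + μ / x²) |u|²` is nonincreasing. -/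
lemma exists_bound_of_oscillator {E : Type*} [NormedAddCommGroup E] [InnerProductSpace ℝ E]
    {μ : ℝ} (hμ : 0 ≤ μ) {u v : ℝ → E} (hu : ∀ x, 0 < x → HasDerivAt u (v x) x)
    (hv : ∀ x, 0 < x → HasDerivAt v (-((1 + μ / x ^ 2) • u x)) x) :
    ∃ C > 0, ∀ x, 1 ≤ x → ‖u x‖ ≤ C ∧ ‖v x‖ ≤ C := by
  set F : ℝ → ℝ := fun x => ‖v x‖ ^ 2 + (1 + μ / x ^ 2) * ‖u x‖ ^ 2 with hF
  have hderiv : ∀ x, 0 < x → HasDerivAt F (-(2 * μ / x ^ 3) * ‖u x‖ ^ 2) x := by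
    intro x hx
    have hw : HasDerivAt (fun y : ℝ => 1 + μ / y ^ 2) (-(2 * μ / x ^ 3)) x := by
      refine (((hasDerivAt_const x μ).div (hasDerivAt_pow 2 x) (by positivity)).const_add
        1).congr_deriv ?_
      simp only [zero_mul, Nat.cast_ofNat, Nat.add_one_sub_one, pow_one, zero_sub]
      field_simp
    refine ((hv x hx).norm_sq.add (hw.mul (hu x hx).norm_sq)).congr_deriv ?_
    rw [inner_neg_right, real_inner_smul_right, real_inner_comm]
    ring
  have hanti : AntitoneOn F (Ici 1) := by
    refine antitoneOn_of_deriv_nonpos (convex_Ici 1)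
      (fun x hx => (hderiv x (zero_lt_one.trans_le hx)).continuousAt.continuousWithinAt)
      (fun x hx => ?_) (fun x hx => ?_)
    all_goals
      rw [interior_Ici] at hx
      have hx0 : 0 < x := zero_lt_one.trans hx
    · exact (hderiv x hx0).differentiableAt.differentiableWithinAt
    · rw [(hderiv x hx0).deriv]
      have : 0 ≤ 2 * μ / x ^ 3 * ‖u x‖ ^ 2 := by positivity
      linarith
  have hF1 : 0 ≤ F 1 := by simp only [hF]; positivity
  refine ⟨Real.sqrt (F 1) + 1, by positivity, fun x hx => ?_⟩
  have hle : F x ≤ F 1 := hanti (mem_Ici.2 le_rfl) hx hx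
  have hpos : 0 ≤ μ / x ^ 2 * ‖u x‖ ^ 2 := by positivity
  have hFx : F x = ‖v x‖ ^ 2 + ‖u x‖ ^ 2 + μ / x ^ 2 * ‖u x‖ ^ 2 := by simp only [hF]; ring
  constructor
  · have := Real.le_sqrt_of_sq_le (show ‖u x‖ ^ 2 ≤ F 1 by nlinarith [sq_nonneg ‖v x‖])
    linarith
  · have := Real.le_sqrt_of_sq_le (show ‖v x‖ ^ 2 ≤ F 1 by nlinarith [sq_nonneg ‖u x‖])
    linarith

lemma exists_bound_sqrt_mul_besselJ {μ : ℝ} (hμ : 0 ≤ μ) {ν : ℂ} (hν : ν ^ 2 = 1 / 4 - μ) :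
    ∃ C > 0, ∃ V : ℝ → ℂ, ∀ x : ℝ, 1 ≤ x →
      HasDerivAt (fun y : ℝ => (Real.sqrt y : ℂ) * besselJ ν y) (V x) x ∧
      ‖(Real.sqrt x : ℂ) * besselJ ν x‖ ≤ C ∧ ‖V x‖ ≤ C := by
  set s : ℂ := ν + 1 / 2 with hs
  set c : ℂ := (1 / 2 : ℂ) ^ ν
  set V : ℝ → ℂ := fun x => c * (s * ((x : ℂ) ^ (s - 1) * besselEntire ν ((x : ℂ) ^ 2 / 4)) -
    1 / 2 * ((x : ℂ) ^ (s + 1) * besselEntire (ν + 1) ((x : ℂ) ^ 2 / 4))) with hV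
  have hu : ∀ x : ℝ, 0 < x →
      HasDerivAt (fun y : ℝ => (Real.sqrt y : ℂ) * besselJ ν y) (V x) x := by
    intro x hx
    have h := (hasDerivAt_ofReal_cpow_mul_besselEntire s ν hx).const_mul c
    have heq : (fun y : ℝ => (Real.sqrt y : ℂ) * besselJ ν y) =ᶠ[nhds x]
        fun y : ℝ => c * ((y : ℂ) ^ s * besselEntire ν ((y : ℂ) ^ 2 / 4)) := by
      filter_upwards [lt_mem_nhds hx] with y hy using sqrt_mul_besselJ ν hy
    refine (h.congr_of_eventuallyEq heq).congr_deriv ?_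
    simp only [hV]; ring
  have hv : ∀ x : ℝ, 0 < x → HasDerivAt V
      (-((1 + μ / x ^ 2) • ((Real.sqrt x : ℂ) * besselJ ν x))) x := by
    intro x hx
    have hxc : (x : ℂ) ≠ 0 := by exact_mod_cast hx.ne'
    have h := (((hasDerivAt_ofReal_cpow_mul_besselEntire (s - 1) ν hx).const_mul s).sub
      ((hasDerivAt_ofReal_cpow_mul_besselEntire (s + 1) (ν + 1) hx).const_mul (1 / 2))).const_mul c
    refine h.congr_deriv ?_
    have hrec := mul_besselEntire_add_two ν ((x : ℂ) ^ 2 / 4)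
    rw [sqrt_mul_besselJ ν hx, Complex.real_smul, show ν + 1 + 1 = ν + 2 by ring,
      show s - 1 + 1 = s by ring, show s + 1 - 1 = s by ring,
      show s - 1 - 1 = s - 2 by ring, show s + 1 + 1 = s + 2 by ring,
      Complex.cpow_sub _ _ hxc, Complex.cpow_add s 2 hxc, ← hs]
    have h2 : (x : ℂ) ^ (2 : ℂ) = (x : ℂ) ^ 2 := by exact_mod_cast Complex.cpow_natCast (x : ℂ) 2
    rw [h2]
    push_cast
    generalize besselEntire ν ((x : ℂ) ^ 2 / 4) = f0 at *
    generalize besselEntire (ν + 1) ((x : ℂ) ^ 2 / 4) = f1 at *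
    generalize besselEntire (ν + 2) ((x : ℂ) ^ 2 / 4) = f2 at *
    generalize (x : ℂ) ^ s = p
    have hss : s * (s - 1) = -μ := by rw [hs]; linear_combination hν
    have hsν : ν = s - 1 / 2 := by rw [hs]; ring
    rw [hsν] at hrec
    field_simp
    linear_combination c * (4 * p * f0) * hss + c * (4 * p * (x : ℂ) ^ 2) * hrec
  obtain ⟨C, hC, h⟩ := exists_bound_of_oscillator hμ hu hv
  exact ⟨C, hC, V, fun x hx => ⟨hu x (zero_lt_one.trans_le hx), h x hx⟩⟩

lemma nuOf_sq (μ : ℝ) : nuOf μ ^ 2 = 1 / 4 - μ := by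
  unfold nuOf
  split_ifs with h
  · have := Real.sq_sqrt (show 0 ≤ 1 - 4 * μ by linarith)
    rw [← Complex.ofReal_pow, div_pow, this]; push_cast; ring
  · have := Real.sq_sqrt (show 0 ≤ 4 * μ - 1 by linarith)
    rw [mul_pow, ← Complex.ofReal_pow, div_pow, this, Complex.I_sq]; push_cast; ring

/-- for `μ ≥ 0`, `μ ≠ 1/4`, there are `N, C > 0` such that for all
`t ≥ 0` and `ξ ≠ 0` with `(1+t)|ξ| ≥ N` one has `|e₊| ≤ C`, `|e₋| ≤ C`,
`|ė₊| ≤ C|ξ|` and `|ė₋| ≤ C|ξ|`. -/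
theorem stmt5 (μ : ℝ) (hμ : 0 ≤ μ) (hμ' : μ ≠ 1 / 4) (d : ℕ) (hd : 1 ≤ d) :
    ∃ N > (0 : ℝ), ∃ C > (0 : ℝ), ∀ t : ℝ, 0 ≤ t →
      ∀ ξ : EuclideanSpace ℝ (Fin d), ξ ≠ 0 → N ≤ (1 + t) * ‖ξ‖ →
        ‖ePlus (nuOf μ) ‖ξ‖ t‖ ≤ C ∧
        ‖eMinus (nuOf μ) ‖ξ‖ t‖ ≤ C ∧
        ‖ePlusDot (nuOf μ) ‖ξ‖ t‖ ≤ C * ‖ξ‖ ∧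
        ‖eMinusDot (nuOf μ) ‖ξ‖ t‖ ≤ C * ‖ξ‖ := by
  obtain ⟨A, hA, V, hV⟩ := exists_bound_sqrt_mul_besselJ hμ (nuOf_sq μ)
  obtain ⟨B, hB, W, hW⟩ := exists_bound_sqrt_mul_besselJ hμ (ν := -nuOf μ)
    (by rw [neg_sq, nuOf_sq])
  set ν := nuOf μ
  set a : ℂ := Complex.cos (ν * (π : ℂ))
  set b : ℂ := Complex.sin (ν * (π : ℂ))
  have hD : ∀ z w : ℂ, ‖z‖ ≤ A → ‖w‖ ≤ B → ‖(z * a - w) / b‖ ≤ (A * ‖a‖ + B) / ‖b‖ := by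
    intro z w hz hw
    rw [norm_div]
    gcongr
    refine (norm_sub_le _ _).trans ?_
    rw [norm_mul]
    gcongr
  have hD0 : 0 ≤ (A * ‖a‖ + B) / ‖b‖ := by positivity
  refine ⟨1, one_pos, A + (A * ‖a‖ + B) / ‖b‖, by positivity, fun t _ ξ _ hN => ?_⟩
  set r := ‖ξ‖
  have hr : 0 ≤ r := norm_nonneg ξ
  obtain ⟨hJd, hJ, hJ'⟩ := hV _ hN
  obtain ⟨hKd, hK, hK'⟩ := hW _ hN
  have hlin : HasDerivAt (fun y : ℝ => (1 + y) * r) r t := by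
    simpa using ((hasDerivAt_id t).const_add 1).mul_const r
  have hplus : HasDerivAt (ePlus ν r) (r • V ((1 + t) * r)) t :=
    HasDerivAt.scomp (g₁ := fun y : ℝ => (Real.sqrt y : ℂ) * besselJ ν y) t hJd hlin
  have hplus' : HasDerivAt (ePlus (-ν) r) (r • W ((1 + t) * r)) t :=
    HasDerivAt.scomp (g₁ := fun y : ℝ => (Real.sqrt y : ℂ) * besselJ (-ν) y) t hKd hlin
  have heq : eMinus ν r = fun y => (ePlus ν r y * a - ePlus (-ν) r y) / b := by
    funext y
    simp only [eMinus, ePlus, besselY, a, b]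
    ring
  have hminus : HasDerivAt (eMinus ν r)
      (r • ((V ((1 + t) * r) * a - W ((1 + t) * r)) / b)) t := by
    rw [heq]
    refine (((hplus.mul_const a).sub hplus').div_const b).congr_deriv ?_
    simp only [Complex.real_smul]
    ring
  refine ⟨hJ.trans (by linarith), ?_, ?_, ?_⟩
  · rw [heq]
    exact (hD _ _ hJ hK).trans (by linarith)
  · rw [ePlusDot, hplus.deriv, norm_smul, Real.norm_of_nonneg hr, mul_comm]
    gcongr
    linarith
  · rw [eMinusDot, hminus.deriv, norm_smul, Real.norm_of_nonneg hr, mul_comm]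
    gcongr
    exact (hD _ _ hJ' hK').trans (by linarith)

end
end

section
/- Let μ = 1/4 (so ν = 0), let d ≥ 1 and let R > 0. Then there exists C > 0 such that for all t, t₀ ≥ 0 and ξ ∈ ℝ^d \ {0} with τ := (1+t)|ξ| ≤ R and τ₀ := (1+t₀)|ξ| ≤ R, the following three estimates hold: |e_+(t,ξ) ė_−(t₀,ξ) − ė_+(t₀,ξ) e_−(t,ξ)| ≤ C τ^{1/2} τ₀^{−1/2} (1 + |log(τ/τ₀)|); |e_+(t₀,ξ) e_−(t,ξ) − e_+(t,ξ) e_−(t₀,ξ)| ≤ C τ^{1/2} τ₀^{1/2} (1 + |log(τ/τ₀)|); |ė_+(t,ξ) ė_−(t₀,ξ) − ė_+(t₀,ξ) ė_−(t,ξ)| ≤ C τ^{−1/2} τ₀^{−1/2} (1 + |log(τ/τ₀)|). -/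
open MeasureTheory Real Set

noncomputable section

/-- An even power series in `z / 2` with coefficients bounded by `1 / k!` is entire. -/
lemma differentiable_tsum_mul_pow_two_mul {a : ℕ → ℂ} (ha : ∀ k, ‖a k‖ ≤ 1 / (k.factorial : ℝ)) :
    Differentiable ℂ fun z : ℂ => ∑' k, a k * (z / 2) ^ (2 * k) := by
  intro z
  have hsum : Summable fun k : ℕ => (‖z‖ + 1) ^ (2 * k) / (k.factorial : ℝ) := by
    simpa only [pow_mul] using Real.summable_pow_div_factorial ((‖z‖ + 1) ^ 2)
  have hd : DifferentiableOn ℂ (fun w : ℂ => ∑' k, a k * (w / 2) ^ (2 * k))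
      (Metric.ball 0 (‖z‖ + 1)) := by
    refine Complex.differentiableOn_tsum_of_summable_norm hsum (fun k => by fun_prop)
      Metric.isOpen_ball fun k w hw => ?_
    have hw' : ‖w / 2‖ ≤ ‖z‖ + 1 := by
      have h1 : ‖w‖ < ‖z‖ + 1 := by simpa using hw
      rw [norm_div, Complex.norm_ofNat]
      linarith [norm_nonneg w]
    rw [norm_mul, norm_pow]
    calc ‖a k‖ * ‖w / 2‖ ^ (2 * k)
        ≤ 1 / (k.factorial : ℝ) * (‖z‖ + 1) ^ (2 * k) := by
          gcongr
          exact ha k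
      _ = (‖z‖ + 1) ^ (2 * k) / (k.factorial : ℝ) := by ring
  exact hd.differentiableAt (Metric.isOpen_ball.mem_nhds (by simp))

/-- The entire function whose restriction to `(0, ∞)` is `J₀`. -/
def besselJ0Entire (z : ℂ) : ℂ :=
  ∑' k : ℕ, (-1 : ℂ) ^ k / ((k.factorial : ℂ) * (k.factorial : ℂ)) * (z / 2) ^ (2 * k)

/-- The non-logarithmic power series of `(π / 2) Y₀`. -/
def besselY0Series (z : ℂ) : ℂ :=
  ∑' k : ℕ, ((-1 : ℂ) ^ ((k + 1) + 1) * ((harmonic (k + 1) : ℚ) : ℂ) /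
    ((Nat.factorial (k + 1) : ℂ)) ^ 2) * (z / 2) ^ (2 * (k + 1))

lemma differentiable_besselJ0Entire : Differentiable ℂ besselJ0Entire := by
  refine differentiable_tsum_mul_pow_two_mul fun k => ?_
  have hk : (1 : ℝ) ≤ k.factorial := by exact_mod_cast k.factorial_pos
  simp only [norm_div, norm_pow, norm_neg, norm_one, one_pow, norm_mul, Complex.norm_natCast]
  gcongr
  nlinarith

lemma harmonic_le_self (n : ℕ) : harmonic n ≤ n := by
  have h : ∀ i ∈ Finset.range n, ((i + 1 : ℕ) : ℚ)⁻¹ ≤ 1 := fun i _ =>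
    inv_le_one_of_one_le₀ (by exact_mod_cast Nat.succ_pos i)
  simpa [harmonic] using Finset.sum_le_sum h

lemma differentiable_besselY0Series : Differentiable ℂ besselY0Series := by
  have h := differentiable_tsum_mul_pow_two_mul
    (a := fun k => (-1 : ℂ) ^ ((k + 1) + 1) * ((harmonic (k + 1) : ℚ) : ℂ) /
      ((Nat.factorial (k + 1) : ℂ)) ^ 2) (fun k => by
    have hpos : (0 : ℝ) < (k + 1).factorial := by exact_mod_cast (k + 1).factorial_pos
    have h0 : (0 : ℝ) ≤ ((harmonic (k + 1) : ℚ) : ℝ) := by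
      exact_mod_cast (harmonic_pos k.succ_ne_zero).le
    have h1 : ((harmonic (k + 1) : ℚ) : ℝ) ≤ (k + 1).factorial := by
      have h2 : ((harmonic (k + 1) : ℚ) : ℝ) ≤ ((k + 1 : ℕ) : ℝ) := by
        exact_mod_cast harmonic_le_self (k + 1)
      exact h2.trans (by exact_mod_cast Nat.self_le_factorial (k + 1))
    have h3 : (k.factorial : ℝ) ≤ (k + 1).factorial := by
      exact_mod_cast Nat.factorial_le k.le_succ
    have h4 : ‖((harmonic (k + 1) : ℚ) : ℂ)‖ = ((harmonic (k + 1) : ℚ) : ℝ) := by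
      rw [← Complex.ofReal_ratCast, Complex.norm_real, Real.norm_of_nonneg h0]
    simp only [norm_div, norm_pow, norm_neg, norm_one, one_pow, norm_mul,
      Complex.norm_natCast, h4, one_mul]
    calc ((harmonic (k + 1) : ℚ) : ℝ) / ((k + 1).factorial : ℝ) ^ 2
        ≤ ((k + 1).factorial : ℝ) / ((k + 1).factorial : ℝ) ^ 2 := by gcongr
      _ = 1 / ((k + 1).factorial : ℝ) := by field_simp
      _ ≤ 1 / (k.factorial : ℝ) := by gcongr)
  have heq : besselY0Series = fun z => (z / 2) ^ 2 * ∑' k : ℕ,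
      ((-1 : ℂ) ^ ((k + 1) + 1) * ((harmonic (k + 1) : ℚ) : ℂ) /
        ((Nat.factorial (k + 1) : ℂ)) ^ 2) * (z / 2) ^ (2 * k) := by
    funext z
    rw [besselY0Series, ← tsum_mul_left]
    exact tsum_congr fun k => by ring
  rw [heq]
  exact Differentiable.mul (by fun_prop) h

lemma besselJ_zero_eq (x : ℝ) : besselJ 0 x = besselJ0Entire x := by
  refine tsum_congr fun k => ?_
  have h : (0 : ℂ) + 2 * (k : ℂ) = ((2 * k : ℕ) : ℂ) := by push_cast; ring
  rw [h, Complex.cpow_natCast, zero_add, Complex.Gamma_nat_eq_factorial]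

lemma besselY0_eq {x : ℝ} (hx : 0 < x) :
    besselY0 x = 2 / (π : ℂ) * ((Real.log x : ℂ) * besselJ0Entire x +
      (((Real.eulerMascheroniConstant - Real.log 2 : ℝ) : ℂ) * besselJ0Entire x +
        besselY0Series x)) := by
  have h : Complex.log ((x : ℂ) / 2) = ((Real.log x - Real.log 2 : ℝ) : ℂ) := by
    rw [← Real.log_div hx.ne' two_ne_zero, Complex.ofReal_log (by positivity)]
    push_cast
    rfl
  rw [besselY0, besselJ_zero_eq, h, besselY0Series]
  push_cast
  ring

/-- Size of `√x F(x)` and of its derivative near the origin, for entire `F`. -/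
lemma exists_bound_sqrt_mul {F : ℂ → ℂ} (hF : Differentiable ℂ F) (R : ℝ) :
    ∃ K > 0, ∀ x : ℝ, 0 < x → x ≤ R →
      ‖(√x : ℂ) * F x‖ ≤ K * √x ∧
      ∃ d : ℂ, HasDerivAt (fun y : ℝ => (√y : ℂ) * F y) d x ∧ ‖d‖ ≤ K * (√x)⁻¹ := by
  have hF' : Continuous (deriv F) := (hF.contDiff (n := 1)).continuous_deriv le_rfl
  obtain ⟨A, hA⟩ := (isCompact_Icc (a := (0 : ℝ)) (b := R)).exists_bound_of_continuousOn
    (f := fun x : ℝ => F x) (hF.continuous.comp Complex.continuous_ofReal).continuousOn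
  obtain ⟨B, hB⟩ := (isCompact_Icc (a := (0 : ℝ)) (b := R)).exists_bound_of_continuousOn
    (f := fun x : ℝ => deriv F x) (hF'.comp Complex.continuous_ofReal).continuousOn
  refine ⟨|A| + |R| * |B| + 1, by positivity, fun x hx hxR => ?_⟩
  have hAx : ‖F x‖ ≤ |A| := (hA x ⟨hx.le, hxR⟩).trans (le_abs_self A)
  have hBx : ‖deriv F x‖ ≤ |B| := (hB x ⟨hx.le, hxR⟩).trans (le_abs_self B)
  have hs : 0 < √x := Real.sqrt_pos.2 hx
  have hRB : 0 ≤ |R| * |B| := by positivity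
  constructor
  · rw [norm_mul, Complex.norm_real, Real.norm_of_nonneg hs.le, mul_comm]
    gcongr
    linarith
  · refine ⟨_, (Real.hasDerivAt_sqrt hx.ne').ofReal_comp.mul
      (hF x).hasDerivAt.comp_ofReal, ?_⟩
    have hs1 : ‖((1 / (2 * √x) : ℝ) : ℂ)‖ ≤ (√x)⁻¹ := by
      rw [Complex.norm_real, Real.norm_of_nonneg (by positivity), inv_eq_one_div]
      gcongr
      linarith
    have hs2 : ‖(√x : ℂ)‖ ≤ |R| * (√x)⁻¹ := by
      rw [Complex.norm_real, Real.norm_of_nonneg hs.le, ← div_eq_mul_inv, le_div_iff₀ hs,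
        Real.mul_self_sqrt hx.le]
      exact hxR.trans (le_abs_self R)
    calc _ ≤ (√x)⁻¹ * |A| + |R| * (√x)⁻¹ * |B| := by
          refine (norm_add_le _ _).trans ?_
          rw [norm_mul, norm_mul]
          gcongr
      _ ≤ (|A| + |R| * |B| + 1) * (√x)⁻¹ := by
          have : 0 < (√x)⁻¹ := by positivity
          nlinarith

/-- Local description of `e₊` and `e₋`: up to the factor `2 / π`, `e₋` is `log τ · e₊` plus a
term of the same size as `e₊`. -/
lemma exists_log_decomposition (R : ℝ) :
    ∃ K > 0, ∀ r t : ℝ, 0 < r → 0 ≤ t → (1 + t) * r ≤ R →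
      ∃ p q u p' q' : ℂ,
        ePlus 0 r t = p ∧ eMinusZ r t = 2 / (π : ℂ) * (Real.log ((1 + t) * r) * p + q) ∧
        ePlusDot 0 r t = r * p' ∧
        eMinusZDot r t = r * (2 / (π : ℂ) * (u + Real.log ((1 + t) * r) * p' + q')) ∧
        ‖p‖ ≤ K * √((1 + t) * r) ∧ ‖q‖ ≤ K * √((1 + t) * r) ∧
        ‖u‖ ≤ K * (√((1 + t) * r))⁻¹ ∧ ‖p'‖ ≤ K * (√((1 + t) * r))⁻¹ ∧
        ‖q'‖ ≤ K * (√((1 + t) * r))⁻¹ := by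
  have hJ := differentiable_besselJ0Entire
  have hG : Differentiable ℂ fun z =>
      ((Real.eulerMascheroniConstant - Real.log 2 : ℝ) : ℂ) * besselJ0Entire z +
        besselY0Series z := (hJ.const_mul _).add differentiable_besselY0Series
  set G : ℂ → ℂ := fun z =>
      ((Real.eulerMascheroniConstant - Real.log 2 : ℝ) : ℂ) * besselJ0Entire z +
        besselY0Series z with hGdef
  obtain ⟨K₁, hK₁, h₁⟩ := exists_bound_sqrt_mul hJ R
  obtain ⟨K₂, hK₂, h₂⟩ := exists_bound_sqrt_mul hG R
  refine ⟨max K₁ K₂, lt_max_of_lt_left hK₁, fun r t hr ht hR => ?_⟩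
  have hx : 0 < (1 + t) * r := by positivity
  obtain ⟨hp, p', hp', hp'b⟩ := h₁ _ hx hR
  obtain ⟨hq, q', hq', hq'b⟩ := h₂ _ hx hR
  have hlin : HasDerivAt (fun s : ℝ => (1 + s) * r) r t := by
    simpa using ((hasDerivAt_id t).const_add 1).mul_const r
  have hplus : ePlus 0 r = fun s : ℝ =>
      (fun y : ℝ => (√y : ℂ) * besselJ0Entire y) ((1 + s) * r) := by
    funext s
    simp only [ePlus, besselJ_zero_eq]
  have hval : ∀ y : ℝ, 0 < y → (√y : ℂ) * besselY0 y =
      2 / (π : ℂ) * ((Real.log y : ℂ) * ((√y : ℂ) * besselJ0Entire y) + (√y : ℂ) * G y) := by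
    intro y hy
    rw [besselY0_eq hy, hGdef]
    ring
  have hder := ((((Real.hasDerivAt_log hx.ne').ofReal_comp.mul hp').add hq').const_mul
    (2 / (π : ℂ))).scomp t hlin
  have hminus : HasDerivAt (eMinusZ r) _ t := hder.congr_of_eventuallyEq (by
    filter_upwards [hlin.continuousAt.eventually (lt_mem_nhds hx)] with s hs
    exact hval _ hs)
  have hK₁m := le_max_left K₁ K₂
  have hK₂m := le_max_right K₁ K₂
  have hs : 0 < √((1 + t) * r) := Real.sqrt_pos.2 hx
  refine ⟨_, _, _, p', q', congrFun hplus t, hval _ hx, ?_, ?_, hp.trans (by gcongr),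
    hq.trans (by gcongr),
    (?_ : ‖((((1 + t) * r)⁻¹ : ℝ) : ℂ) *
      ((√((1 + t) * r) : ℂ) * besselJ0Entire (((1 + t) * r : ℝ) : ℂ))‖ ≤ _),
    hp'b.trans (by gcongr), hq'b.trans (by gcongr)⟩
  · rw [ePlusDot, hplus]
    exact (hp'.scomp t hlin).deriv.trans Complex.real_smul
  · refine hminus.deriv.trans ?_
    simp only [Complex.real_smul]
  · rw [norm_mul, Complex.norm_real, Real.norm_of_nonneg (by positivity)]
    calc ((1 + t) * r)⁻¹ * _ ≤ ((1 + t) * r)⁻¹ * (K₁ * √((1 + t) * r)) := by gcongr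
      _ = K₁ * (√((1 + t) * r))⁻¹ := by
          have := Real.mul_self_sqrt hx.le
          field_simp
          nlinarith
      _ ≤ _ := by gcongr

lemma norm_mul_le_of_le_mul {x y : ℂ} {K a b : ℝ} (hx : ‖x‖ ≤ K * a) (hy : ‖y‖ ≤ K * b) :
    ‖x * y‖ ≤ K ^ 2 * (a * b) := by
  rw [norm_mul]
  calc ‖x‖ * ‖y‖ ≤ (K * a) * (K * b) :=
        mul_le_mul hx hy (norm_nonneg _) ((norm_nonneg _).trans hx)
    _ = K ^ 2 * (a * b) := by ring

/-- A combination of five terms of common size `M`, one of them with a logarithmic factor. -/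
lemma norm_combination_le {c v w₁ w₂ w₃ w₄ : ℂ} {m M S : ℝ} (hc : ‖c‖ ≤ S)
    (hv : ‖v‖ ≤ M) (h₁ : ‖w₁‖ ≤ M) (h₂ : ‖w₂‖ ≤ M) (h₃ : ‖w₃‖ ≤ M) (h₄ : ‖w₄‖ ≤ M) :
    ‖c * ((m : ℂ) * v + w₁ + w₂ + w₃ + w₄)‖ ≤ S * (4 * M * (1 + |m|)) := by
  have hM : 0 ≤ M := (norm_nonneg _).trans hv
  have hmv : ‖(m : ℂ) * v‖ ≤ |m| * M := by
    rw [norm_mul, Complex.norm_real, Real.norm_eq_abs]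
    gcongr
  have hsum : ‖(m : ℂ) * v + w₁ + w₂ + w₃ + w₄‖ ≤ 4 * M * (1 + |m|) := by
    refine norm_add_le_of_le (norm_add_le_of_le (norm_add_le_of_le
      (norm_add_le_of_le hmv h₁) h₂) h₃) h₄ |>.trans ?_
    nlinarith [abs_nonneg m, mul_nonneg (abs_nonneg m) hM]
  rw [norm_mul]
  exact mul_le_mul hc hsum (norm_nonneg _) ((norm_nonneg _).trans hc)

/-- case `μ = 1/4` (`ν = 0`): Wronskian-type small-argument bounds
with logarithmic factors, for `τ = (1+t)|ξ| ≤ R` and `τ₀ = (1+t₀)|ξ| ≤ R`. -/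
theorem stmt8 (d : ℕ) (hd : 1 ≤ d) (R : ℝ) (hR : 0 < R) :
    ∃ C > (0 : ℝ), ∀ t t₀ : ℝ, 0 ≤ t → 0 ≤ t₀ →
      ∀ ξ : EuclideanSpace ℝ (Fin d), ξ ≠ 0 →
        (1 + t) * ‖ξ‖ ≤ R → (1 + t₀) * ‖ξ‖ ≤ R →
        ‖ePlus 0 ‖ξ‖ t * eMinusZDot ‖ξ‖ t₀ - ePlusDot 0 ‖ξ‖ t₀ * eMinusZ ‖ξ‖ t‖ ≤
          C * ((1 + t) * ‖ξ‖) ^ ((1 : ℝ) / 2) * ((1 + t₀) * ‖ξ‖) ^ (-(1 : ℝ) / 2) *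
            (1 + |Real.log (((1 + t) * ‖ξ‖) / ((1 + t₀) * ‖ξ‖))|) ∧
        ‖ePlus 0 ‖ξ‖ t₀ * eMinusZ ‖ξ‖ t - ePlus 0 ‖ξ‖ t * eMinusZ ‖ξ‖ t₀‖ ≤
          C * ((1 + t) * ‖ξ‖) ^ ((1 : ℝ) / 2) * ((1 + t₀) * ‖ξ‖) ^ ((1 : ℝ) / 2) *
            (1 + |Real.log (((1 + t) * ‖ξ‖) / ((1 + t₀) * ‖ξ‖))|) ∧
        ‖ePlusDot 0 ‖ξ‖ t * eMinusZDot ‖ξ‖ t₀ - ePlusDot 0 ‖ξ‖ t₀ * eMinusZDot ‖ξ‖ t‖ ≤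
          C * ((1 + t) * ‖ξ‖) ^ (-(1 : ℝ) / 2) * ((1 + t₀) * ‖ξ‖) ^ (-(1 : ℝ) / 2) *
            (1 + |Real.log (((1 + t) * ‖ξ‖) / ((1 + t₀) * ‖ξ‖))|) := by
  obtain ⟨K, hK, h⟩ := exists_log_decomposition R
  refine ⟨4 * K ^ 2 * (1 + R) ^ 2, by positivity, fun t t₀ ht ht₀ ξ hξ hx hx₀ => ?_⟩
  have hr : 0 < ‖ξ‖ := norm_pos_iff.2 hξ
  have hrR : ‖ξ‖ ≤ R := by nlinarith
  obtain ⟨p, q, u, p', q', e₁, e₂, e₃, e₄, hp, hq, hu, hp', hq'⟩ := h _ t hr ht hx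
  obtain ⟨p₀, q₀, u₀, p₀', q₀', f₁, f₂, f₃, f₄, hp₀, hq₀, hu₀, hp₀', hq₀'⟩ := h _ t₀ hr ht₀ hx₀
  rw [e₁, e₂, e₃, e₄, f₁, f₂, f₃, f₄]
  have hxpos : 0 < (1 + t) * ‖ξ‖ := by positivity
  have hx₀pos : 0 < (1 + t₀) * ‖ξ‖ := by positivity
  have hhalf : ∀ y : ℝ, 0 < y → y ^ (-(1 : ℝ) / 2) = (√y)⁻¹ := fun y hy => by
    rw [neg_div, Real.rpow_neg hy.le, Real.sqrt_eq_rpow]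
  rw [hhalf _ hxpos, hhalf _ hx₀pos, ← Real.sqrt_eq_rpow, ← Real.sqrt_eq_rpow,
    Real.log_div hxpos.ne' hx₀pos.ne']
  generalize (1 + t) * ‖ξ‖ = x at *
  generalize (1 + t₀) * ‖ξ‖ = x₀ at *
  generalize ‖ξ‖ = r at *
  generalize Real.log x = L at *
  generalize Real.log x₀ = L₀ at *
  have ha : 0 < √x := Real.sqrt_pos.2 hxpos
  have hb : 0 < √x₀ := Real.sqrt_pos.2 hx₀pos
  generalize √x = a at *
  generalize √x₀ = b at *
  have hpi : ‖(2 / (π : ℂ))‖ ≤ 1 := by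
    rw [norm_div, Complex.norm_ofNat, Complex.norm_real, Real.norm_of_nonneg Real.pi_pos.le,
      div_le_one Real.pi_pos]
    linarith [Real.pi_gt_three]
  have hrn : ‖(r : ℂ)‖ ≤ R := by rwa [Complex.norm_real, Real.norm_of_nonneg hr.le]
  have hz : ∀ M : ℝ, 0 ≤ M → ‖(0 : ℂ)‖ ≤ M := fun M hM => by simpa using hM
  have hc₁ : ‖(r : ℂ) * (2 / (π : ℂ))‖ ≤ (1 + R) ^ 2 := by
    rw [norm_mul]
    nlinarith [norm_nonneg (r : ℂ), norm_nonneg (2 / (π : ℂ))]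
  have hc₂ : ‖(2 / (π : ℂ))‖ ≤ (1 + R) ^ 2 := hpi.trans (by nlinarith)
  have hc₃ : ‖(r : ℂ) * (r : ℂ) * (2 / (π : ℂ))‖ ≤ (1 + R) ^ 2 := by
    rw [norm_mul, norm_mul]
    calc ‖(r : ℂ)‖ * ‖(r : ℂ)‖ * ‖(2 / (π : ℂ))‖ ≤ R * R * 1 := by gcongr
      _ ≤ (1 + R) ^ 2 := by nlinarith
  refine ⟨?_, ?_, ?_⟩
  · have key := norm_combination_le (m := L - L₀) hc₁
      (norm_neg (p * p₀') ▸ norm_mul_le_of_le_mul hp hp₀')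
      (norm_mul_le_of_le_mul hp hu₀) (norm_mul_le_of_le_mul hp hq₀')
      (norm_neg (q * p₀') ▸ norm_mul_le_of_le_mul hq hp₀') (hz _ (by positivity))
    refine le_of_eq_of_le (congrArg _ ?_) (key.trans_eq (by ring))
    push_cast
    ring
  · have key := norm_combination_le (m := L - L₀) hc₂
      (norm_mul_le_of_le_mul hp hp₀) (norm_mul_le_of_le_mul hq hp₀)
      (norm_neg (p * q₀) ▸ norm_mul_le_of_le_mul hp hq₀)
      (hz _ (by positivity)) (hz _ (by positivity))
    refine le_of_eq_of_le (congrArg _ ?_) (key.trans_eq (by ring))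
    push_cast
    ring
  · have key := norm_combination_le (m := L - L₀) hc₃
      (norm_neg (p' * p₀') ▸ norm_mul_le_of_le_mul hp' hp₀')
      (norm_mul_le_of_le_mul hp' hu₀) (norm_mul_le_of_le_mul hp' hq₀')
      (norm_neg (u * p₀') ▸ norm_mul_le_of_le_mul hu hp₀')
      (norm_neg (q' * p₀') ▸ norm_mul_le_of_le_mul hq' hp₀')
    refine le_of_eq_of_le (congrArg _ ?_) (key.trans_eq (by ring))
    push_cast
    ring

end
end
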